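/- arXiv:1607.00177 — 2 statements merged into one kernel-verified Lean document; each statement's English description precedes it below -/
import Mathlib

section
/- Let γ > 1, and let n : ℝ³ × ℝ → ℝ and v : ℝ³ × ℝ → ℝ³ be smooth, ℤ³-periodic in the space variable, with n(x, t) > 0 everywhere, satisfying the continuity equation ∂_t n + div(nv) = 0. Then for every t, the function t ↦ ∫_{[0,1]³} n^γ dx is differentiable and ∫_{[0,1]³} v · ∇(n^γ) dx = (1/(γ−1)) · d/dt ∫_{[0,1]³} n^γ dx. -/
open MeasureTheory

/-- Spatial partial derivative in the i-th coordinate direction. -/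
noncomputable def pd (i : Fin 3) (f : (Fin 3 → ℝ) → ℝ) (x : Fin 3 → ℝ) : ℝ :=
  fderiv ℝ f x (Pi.single i 1)

theorem pd_continuous {f : (Fin 3 → ℝ) → ℝ} (hf : ContDiff ℝ 1 f) (i : Fin 3) :
    Continuous (pd i f) :=
  (hf.continuous_fderiv one_ne_zero).clm_apply continuous_const

theorem pd_mul {f g : (Fin 3 → ℝ) → ℝ} {x : Fin 3 → ℝ} (hf : DifferentiableAt ℝ f x)
    (hg : DifferentiableAt ℝ g x) (i : Fin 3) :
    pd i (fun y => f y * g y) x = f x * pd i g x + g x * pd i f x := by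
  simp [pd, fderiv_fun_mul hf hg]

theorem pd_rpow_const {f : (Fin 3 → ℝ) → ℝ} {x : Fin 3 → ℝ} (hf : DifferentiableAt ℝ f x)
    (hx : f x ≠ 0) (p : ℝ) (i : Fin 3) :
    pd i (fun y => f y ^ p) x = p * f x ^ (p - 1) * pd i f x := by
  simp [pd, (hf.hasFDerivAt.rpow_const (p := p) (Or.inl hx)).fderiv]

/-- The divergence of a `C¹` periodic vector field integrates to zero over a period cell. -/
theorem integral_divergence_eq_zero_of_periodic (F : Fin 3 → (Fin 3 → ℝ) → ℝ)
    (hF : ∀ i, ContDiff ℝ 1 (F i))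
    (hper : ∀ i x (k : Fin 3 → ℤ), F i (x + fun j => (k j : ℝ)) = F i x) :
    ∫ x in Set.Icc (0 : Fin 3 → ℝ) 1, ∑ i, pd i (F i) x = 0 := by
  have hdiv := integral_divergence_of_hasFDerivAt_off_countable' (0 : Fin 3 → ℝ) 1
    zero_le_one F (fun i => fderiv ℝ (F i)) ∅ Set.countable_empty
    (fun i => (hF i).continuous.continuousOn)
    (fun x _ i => ((hF i).differentiable one_ne_zero x).hasFDerivAt)
    ((continuous_finsetSum _ fun i _ => pd_continuous (hF i) i).continuousOn.integrableOn_compact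
      isCompact_Icc)
  refine hdiv.trans (Finset.sum_eq_zero fun i _ => sub_eq_zero.2 ?_)
  congr 1 with x
  rw [← hper i (Fin.insertNth i ((0 : Fin 3 → ℝ) i) x) (Pi.single i 1)]
  congr 1
  ext j
  induction j using i.succAboveCases <;> simp

/-- Differentiation under the integral sign over a compact set, for a `C¹` integrand. -/
theorem hasDerivAt_setIntegral_of_contDiff {E : Type*} [NormedAddCommGroup E] [NormedSpace ℝ E]
    [MeasurableSpace E] [BorelSpace E] [SecondCountableTopology E] {μ : Measure E}
    [IsFiniteMeasureOnCompacts μ] {f : E × ℝ → ℝ} (hf : ContDiff ℝ 1 f) {K : Set E}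
    (hK : IsCompact K) (t : ℝ) :
    HasDerivAt (fun τ => ∫ x in K, f (x, τ) ∂μ) (∫ x in K, deriv (fun s => f (x, s)) t ∂μ) t := by
  have hd (x : E) (τ : ℝ) : HasDerivAt (fun s => f (x, s)) (fderiv ℝ f (x, τ) (0, 1)) τ :=
    (hf.differentiable one_ne_zero (x, τ)).hasFDerivAt.comp_hasDerivAt τ
      ((hasDerivAt_const τ x).prodMk (hasDerivAt_id τ))
  have hc : Continuous fun p => fderiv ℝ f p (0, 1) :=
    (hf.continuous_fderiv one_ne_zero).clm_apply continuous_const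
  obtain ⟨C, hC⟩ := (hK.prod (isCompact_closedBall t 1)).exists_bound_of_continuousOn
    hc.continuousOn
  simp_rw [fun x => (hd x t).deriv]
  refine (hasDerivAt_integral_of_dominated_loc_of_deriv_le (bound := fun _ => C)
    (F' := fun τ x => fderiv ℝ f (x, τ) (0, 1)) (Metric.closedBall_mem_nhds t one_pos)
    (.of_forall fun τ => ?_) ?_ ?_ ?_ ?_ (.of_forall fun x τ _ => hd x τ)).2
  · exact (hf.continuous.comp (by fun_prop : Continuous fun x : E => (x, τ))).aestronglyMeasurable
  · exact (hf.continuous.comp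
      (by fun_prop : Continuous fun x : E => (x, t))).continuousOn.integrableOn_compact hK
  · exact (hc.comp (by fun_prop : Continuous fun x : E => (x, t))).aestronglyMeasurable
  · exact ae_restrict_of_forall_mem hK.measurableSet fun x hx τ hτ => hC (x, τ) ⟨hx, hτ⟩
  · exact integrableOn_const hK.measure_lt_top.ne

/-- For smooth ℤ³-periodic positive (n, v) satisfying the continuity equation
and γ > 1, the map t ↦ ∫_{[0,1]³} n^γ dx is differentiable and
∫_{[0,1]³} v · ∇(n^γ) dx = (1/(γ−1)) d/dt ∫_{[0,1]³} n^γ dx. -/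
theorem pressure_time_derivative
    (γ : ℝ) (hγ : 1 < γ)
    (n : (Fin 3 → ℝ) × ℝ → ℝ) (v : (Fin 3 → ℝ) × ℝ → Fin 3 → ℝ)
    (hn : ContDiff ℝ (⊤ : ℕ∞) n) (hv : ContDiff ℝ (⊤ : ℕ∞) v)
    (hnper : ∀ (x : Fin 3 → ℝ) (t : ℝ) (k : Fin 3 → ℤ),
      n ((x + fun i => (k i : ℝ)), t) = n (x, t))
    (hvper : ∀ (x : Fin 3 → ℝ) (t : ℝ) (k : Fin 3 → ℤ),
      v ((x + fun i => (k i : ℝ)), t) = v (x, t))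
    (hnpos : ∀ p, 0 < n p)
    (hcont : ∀ (x : Fin 3 → ℝ) (t : ℝ),
      deriv (fun s => n (x, s)) t
        + ∑ i, pd i (fun y => n (y, t) * v (y, t) i) x = 0) :
    ∀ t : ℝ, ∃ D : ℝ,
      HasDerivAt (fun τ => ∫ x in Set.Icc (0 : Fin 3 → ℝ) 1, n (x, τ) ^ γ) D t ∧
      (∫ x in Set.Icc (0 : Fin 3 → ℝ) 1,
          ∑ i, v (x, t) i * pd i (fun y => n (y, t) ^ γ) x)
        = (1 / (γ - 1)) * D := by
  intro t
  have hn1 : ContDiff ℝ 1 n := hn.of_le (by exact_mod_cast le_top)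
  have hv1 : ContDiff ℝ 1 v := hv.of_le (by exact_mod_cast le_top)
  have hp : ContDiff ℝ 1 fun q => n q ^ γ := hn1.rpow_const_of_ne fun q => (hnpos q).ne'
  have hι : ContDiff ℝ 1 fun y : Fin 3 → ℝ => (y, t) := contDiff_id.prodMk contDiff_const
  have hnt : ContDiff ℝ 1 fun y => n (y, t) := hn1.comp hι
  have hvt (i : Fin 3) : ContDiff ℝ 1 fun y => v (y, t) i := contDiff_pi.1 (hv1.comp hι) i
  have hpt : ContDiff ℝ 1 fun y => n (y, t) ^ γ := hp.comp hι
  refine ⟨_, hasDerivAt_setIntegral_of_contDiff hp isCompact_Icc t, ?_⟩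
  have hflux (i : Fin 3) : ContDiff ℝ 1 fun y => n (y, t) ^ γ * v (y, t) i := hpt.mul (hvt i)
  have hzero := integral_divergence_eq_zero_of_periodic
    (fun i y => n (y, t) ^ γ * v (y, t) i) hflux fun i x k => by simp only [hnper, hvper]
  have hpoint (x : Fin 3 → ℝ) : deriv (fun s => n (x, s) ^ γ) t
      = (γ - 1) * ∑ i, v (x, t) i * pd i (fun y => n (y, t) ^ γ) x
        - γ * ∑ i, pd i (fun y => n (y, t) ^ γ * v (y, t) i) x := by
    have hnx := hnt.differentiable one_ne_zero x
    have hvx (i : Fin 3) := (hvt i).differentiable one_ne_zero x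
    have hns : DifferentiableAt ℝ (fun s => n (x, s)) t :=
      (hn1.comp (contDiff_const.prodMk contDiff_id)).differentiable one_ne_zero t
    have hpow : n (x, t) ^ γ = n (x, t) ^ (γ - 1) * n (x, t) := by
      rw [← Real.rpow_add_one (hnpos _).ne', sub_add_cancel]
    have hc := hcont x t
    simp only [fun i => pd_mul hnx (hvx i) i] at hc
    simp only [fun i => pd_mul (hpt.differentiable one_ne_zero x) (hvx i) i,
      pd_rpow_const hnx (hnpos (x, t)).ne',
      (hns.hasDerivAt.rpow_const (p := γ) (Or.inl (hnpos (x, t)).ne')).deriv, hpow,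
      Fin.sum_univ_three] at hc ⊢
    linear_combination γ * n (x, t) ^ (γ - 1) * hc
  have hint1 : IntegrableOn (fun x => ∑ i, v (x, t) i * pd i (fun y => n (y, t) ^ γ) x)
      (Set.Icc (0 : Fin 3 → ℝ) 1) :=
    (continuous_finsetSum _ fun i _ =>
      (hvt i).continuous.mul (pd_continuous hpt i)).continuousOn.integrableOn_compact isCompact_Icc
  have hint2 : IntegrableOn (fun x => ∑ i, pd i (fun y => n (y, t) ^ γ * v (y, t) i) x)
      (Set.Icc (0 : Fin 3 → ℝ) 1) :=
    (continuous_finsetSum _ fun i _ =>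
      pd_continuous (hflux i) i).continuousOn.integrableOn_compact isCompact_Icc
  simp_rw [hpoint]
  rw [integral_sub (hint1.const_mul _) (hint2.const_mul _), integral_const_mul,
    integral_const_mul, hzero]
  field_simp [(sub_pos.2 hγ).ne']
  ring
end

section
/- Let γ > 1, μ > 0, λ ∈ ℝ with λ + 2μ > 0. Let ρ, n : ℝ³ × ℝ → ℝ and u, v : ℝ³ × ℝ → ℝ³ be smooth, ℤ³-periodic in the space variable, with ρ > 0 and n > 0 everywhere, satisfying ∂_t ρ + div(ρu) = 0, ∂_t(ρu) + div(ρ u ⊗ u) + ∇ρ = −ρ(u − v), ∂_t n + div(nv) = 0, ∂_t(nv) + div(n v ⊗ v) + ∇(n^γ) + Lv = ρ(u − v), with Lv = −μΔv − (μ+λ)∇(div v). Set ρ_c := ∫_{[0,1]³} ρ dx and n_c := ∫_{[0,1]³} n dx (constants in t), m_c(t) := (1/ρ_c)∫_{[0,1]³} ρu dx, j_c(t) := (1/n_c)∫_{[0,1]³} nv dx, and define 𝓔(t) := (1/2)∫ ρ|u−m_c|² dx + ∫ ρ (∫_{ρ_c}^{ρ} (s−ρ_c)/s² ds) dx + (1/2)∫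 n|v−j_c|² dx + ∫ n (∫_{n_c}^{n} (s^γ − n_c^γ)/s² ds) dx + (1/2)(n_c ρ_c/(n_c + ρ_c))|m_c − j_c|², and 𝓓(t) := μ∫ |∇v|² dx + (μ+λ)∫ |div v|² dx + ∫ ρ|u−v|² dx (all spatial integrals over [0,1]³). Then 𝓔 is differentiable in t and 𝓔′(t) + 𝓓(t) = 0 for all t. -/
open MeasureTheory

/-- The derivative of a function on space-time at `p` in the direction `w`. -/
noncomputable def dirDeriv (w : (Fin 3 → ℝ) × ℝ) (F : (Fin 3 → ℝ) × ℝ → ℝ)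
    (p : (Fin 3 → ℝ) × ℝ) : ℝ :=
  fderiv ℝ F p w

/-- The space-time direction of time. -/
def timeDir : (Fin 3 → ℝ) × ℝ := (0, 1)

/-- The space-time direction of the `i`-th space coordinate. -/
def spaceDir (i : Fin 3) : (Fin 3 → ℝ) × ℝ := (Pi.single i 1, 0)

/-- A function on space-time that is `ℤ³`-periodic in space. -/
def SpacePeriodic {α : Type*} (F : (Fin 3 → ℝ) × ℝ → α) : Prop :=
  ∀ (x : Fin 3 → ℝ) (t : ℝ) (k : Fin 3 → ℤ), F ((x + fun i => (k i : ℝ)), t) = F (x, t)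

section DirDeriv

variable {F G : (Fin 3 → ℝ) × ℝ → ℝ} {w p : (Fin 3 → ℝ) × ℝ}

lemma dirDeriv_add (hF : Differentiable ℝ F) (hG : Differentiable ℝ G) :
    dirDeriv w (fun q => F q + G q) p = dirDeriv w F p + dirDeriv w G p := by
  simp [dirDeriv, fderiv_fun_add (hF p) (hG p)]

lemma dirDeriv_mul (hF : Differentiable ℝ F) (hG : Differentiable ℝ G) :
    dirDeriv w (fun q => F q * G q) p = dirDeriv w F p * G p + F p * dirDeriv w G p := by
  simp [dirDeriv, fderiv_fun_mul (hF p) (hG p)]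
  ring

lemma dirDeriv_const (c : ℝ) : dirDeriv w (fun _ => c) p = 0 := by
  simp [dirDeriv]

lemma dirDeriv_const_mul (c : ℝ) (hF : Differentiable ℝ F) :
    dirDeriv w (fun q => c * F q) p = c * dirDeriv w F p := by
  simp [dirDeriv_mul (F := fun _ => c) (differentiable_const c) hF, dirDeriv_const]

lemma dirDeriv_comp {Φ : ℝ → ℝ} {Φ' : ℝ} (hΦ : HasDerivAt Φ Φ' (F p))
    (hF : Differentiable ℝ F) :
    dirDeriv w (fun q => Φ (F q)) p = Φ' * dirDeriv w F p := by
  have := (hΦ.comp_hasFDerivAt p (hF p).hasFDerivAt).fderiv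
  simp only [Function.comp_def] at this
  simp [dirDeriv, this]

lemma ContDiff.dirDeriv {m n : WithTop ℕ∞} (hF : ContDiff ℝ n F) (h : m + 1 ≤ n) :
    ContDiff ℝ m (dirDeriv w F) :=
  (hF.fderiv_right h).clm_apply contDiff_const

lemma SpacePeriodic.dirDeriv (hF : SpacePeriodic F) : SpacePeriodic (dirDeriv w F) := by
  intro x t k
  have h : (fun q => F (q + (fun i => (k i : ℝ), (0 : ℝ)))) = F := by
    funext ⟨y, s⟩
    simpa using hF y s k
  have h2 := fderiv_comp_add_right (𝕜 := ℝ) (f := F) (x := (x, t))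
    (fun i => (k i : ℝ), (0 : ℝ))
  rw [h] at h2
  simp [_root_.dirDeriv, h2]

lemma hasDerivAt_time (hF : Differentiable ℝ F) (x : Fin 3 → ℝ) (t : ℝ) :
    HasDerivAt (fun s => F (x, s)) (dirDeriv timeDir F (x, t)) t := by
  have h : HasDerivAt (fun s : ℝ => (x, s)) ((0 : Fin 3 → ℝ), (1 : ℝ)) t :=
    (hasDerivAt_const t x).prodMk (hasDerivAt_id t)
  exact (hF (x, t)).hasFDerivAt.comp_hasDerivAt t h

lemma deriv_time (hF : Differentiable ℝ F) (x : Fin 3 → ℝ) (t : ℝ) :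
    deriv (fun s => F (x, s)) t = dirDeriv timeDir F (x, t) :=
  (hasDerivAt_time hF x t).deriv

lemma pd_slice (hF : Differentiable ℝ F) (i : Fin 3) (x : Fin 3 → ℝ) (t : ℝ) :
    pd i (fun y => F (y, t)) x = dirDeriv (spaceDir i) F (x, t) := by
  have h : HasFDerivAt (fun y : Fin 3 → ℝ => (y, t))
      (ContinuousLinearMap.inl ℝ (Fin 3 → ℝ) ℝ) x := hasFDerivAt_prodMk_left x t
  have h2 := ((hF (x, t)).hasFDerivAt.comp x h).fderiv
  simp only [Function.comp_def] at h2
  simp [pd, h2, dirDeriv, spaceDir]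

end DirDeriv

section Integrals

lemma integrableOn_slice {F : (Fin 3 → ℝ) × ℝ → ℝ} (hF : Continuous F) (t : ℝ) :
    IntegrableOn (fun x => F (x, t)) (Set.Icc (0 : Fin 3 → ℝ) 1) :=
  (hF.comp (by fun_prop)).continuousOn.integrableOn_compact isCompact_Icc

lemma hasDerivAt_integral_slice {F : (Fin 3 → ℝ) × ℝ → ℝ} (hF : ContDiff ℝ 1 F) (t : ℝ) :
    HasDerivAt (fun s => ∫ x in Set.Icc (0 : Fin 3 → ℝ) 1, F (x, s))
      (∫ x in Set.Icc (0 : Fin 3 → ℝ) 1, dirDeriv timeDir F (x, t)) t := by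
  have hcont : Continuous (dirDeriv timeDir F) := (hF.dirDeriv (m := 0) (by simp)).continuous
  obtain ⟨C, hC⟩ := ((isCompact_Icc (a := (0 : Fin 3 → ℝ)) (b := 1)).prod
    (isCompact_closedBall t 1)).exists_bound_of_continuousOn hcont.continuousOn
  refine (hasDerivAt_integral_of_dominated_loc_of_deriv_le
    (F' := fun s x => dirDeriv timeDir F (x, s)) (bound := fun _ => C)
    (Metric.closedBall_mem_nhds t one_pos)
    (Filter.Eventually.of_forall fun s =>
      (integrableOn_slice hF.continuous s).aestronglyMeasurable)
    (integrableOn_slice hF.continuous t) (integrableOn_slice hcont t).aestronglyMeasurable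
    ?_ (integrableOn_const (by simp [isCompact_Icc.measure_lt_top.ne]))
    (Filter.Eventually.of_forall fun x s _ =>
      hasDerivAt_time (hF.differentiable (by simp)) x s)).2
  filter_upwards [ae_restrict_mem measurableSet_Icc] with x hx s hs
  exact hC (x, s) ⟨hx, hs⟩

lemma integral_pd_eq_zero {f : (Fin 3 → ℝ) → ℝ} (hf : ContDiff ℝ 1 f)
    (hper : ∀ (x : Fin 3 → ℝ) (k : Fin 3 → ℤ), f (x + fun i => (k i : ℝ)) = f x) (i : Fin 3) :
    ∫ x in Set.Icc (0 : Fin 3 → ℝ) 1, pd i f x = 0 := by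
  have hsum : ∀ x, ∑ j, (if j = i then fderiv ℝ f x else 0) (Pi.single j 1) = pd i f x := by
    intro x
    rw [Finset.sum_eq_single i (fun j _ hj => by simp [hj]) (by simp)]
    simp [pd]
  have hcont : Continuous (pd i f) :=
    (hf.continuous_fderiv (by simp)).clm_apply continuous_const
  have key := integral_divergence_of_hasFDerivAt_off_countable' (0 : Fin 3 → ℝ) 1
    zero_le_one (fun j => if j = i then f else 0)
    (fun j x => if j = i then fderiv ℝ f x else 0) ∅ Set.countable_empty
    (fun j => by
      split_ifs
      · exact hf.continuous.continuousOn
      · exact continuousOn_const)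
    (fun x _ j => by
      split_ifs
      · exact (hf.differentiable (by simp) x).hasFDerivAt
      · exact hasFDerivAt_const 0 x)
    (by
      simp only [hsum]
      exact hcont.continuousOn.integrableOn_compact isCompact_Icc)
  simp only [hsum] at key
  rw [key]
  refine Finset.sum_eq_zero fun j _ => ?_
  by_cases hj : j = i
  · subst hj
    simp only [if_true]
    rw [sub_eq_zero]
    congr 1
    funext x
    rw [← hper (j.insertNth ((0 : Fin 3 → ℝ) j) x) (Pi.single j 1)]
    congr 1
    funext l
    refine Fin.succAboveCases j ?_ (fun m => ?_) l
    · simp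
    · simp [Fin.succAbove_ne]
  · simp [hj]

/-- A balance law with spatially periodic flux, integrated over the unit cube. -/
lemma hasDerivAt_integral_of_balance {F H : (Fin 3 → ℝ) × ℝ → ℝ}
    {G : Fin 3 → (Fin 3 → ℝ) × ℝ → ℝ} (hF : ContDiff ℝ 1 F) (hG : ∀ i, ContDiff ℝ 1 (G i))
    (hper : ∀ i, SpacePeriodic (G i))
    (hbal : ∀ p, dirDeriv timeDir F p + ∑ i, dirDeriv (spaceDir i) (G i) p = H p) (t : ℝ) :
    HasDerivAt (fun s => ∫ x in Set.Icc (0 : Fin 3 → ℝ) 1, F (x, s))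
      (∫ x in Set.Icc (0 : Fin 3 → ℝ) 1, H (x, t)) t := by
  convert hasDerivAt_integral_slice hF t using 1
  have hGi : ∀ i, IntegrableOn (fun x => dirDeriv (spaceDir i) (G i) (x, t))
      (Set.Icc (0 : Fin 3 → ℝ) 1) := fun i =>
    integrableOn_slice ((hG i).dirDeriv (m := 0) (by simp)).continuous t
  simp only [← hbal]
  rw [integral_add (integrableOn_slice (hF.dirDeriv (m := 0) (by simp)).continuous t)
    (integrable_finsetSum _ fun i _ => hGi i), integral_finsetSum _ fun i _ => hGi i,
    Finset.sum_eq_zero, add_zero]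
  intro i _
  simp only [← pd_slice ((hG i).differentiable (by simp))]
  exact integral_pd_eq_zero (f := fun y => G i (y, t)) ((hG i).comp (by fun_prop)) (fun x k => hper i x t k) i

end Integrals

section LocalBalance

variable {R : (Fin 3 → ℝ) × ℝ → ℝ} {U : Fin 3 → (Fin 3 → ℝ) × ℝ → ℝ}
  {p : (Fin 3 → ℝ) × ℝ}

lemma kinetic_balance (hR : Differentiable ℝ R) (hU : ∀ i, Differentiable ℝ (U i))
    (hmass : dirDeriv timeDir R p + ∑ i, dirDeriv (spaceDir i) (fun q => R q * U i q) p = 0) :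
    dirDeriv timeDir (fun q => 1 / 2 * (R q * ∑ i, U i q ^ 2)) p
      + ∑ j, dirDeriv (spaceDir j) (fun q => 1 / 2 * (R q * ∑ i, U i q ^ 2) * U j q) p
    = ∑ i, U i p * (dirDeriv timeDir (fun q => R q * U i q) p
      + ∑ j, dirDeriv (spaceDir j) (fun q => R q * U i q * U j q) p) := by
  simp only [Fin.sum_univ_three, pow_two] at hmass ⊢
  simp (disch := fun_prop) only [dirDeriv_mul, dirDeriv_add, dirDeriv_const] at hmass ⊢
  linear_combination (-(1 / 2) * (U 0 p ^ 2 + U 1 p ^ 2 + U 2 p ^ 2)) * hmass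

lemma internal_balance {Φ P : ℝ → ℝ} {c Φ' P' : ℝ} (hR : Differentiable ℝ R)
    (hU : ∀ i, Differentiable ℝ (U i))
    (hΦR : Differentiable ℝ fun q => Φ (R q)) (hPR : Differentiable ℝ fun q => P (R q))
    (hΦ : HasDerivAt Φ Φ' (R p)) (hP : HasDerivAt P P' (R p))
    (hΦP : R p * Φ' = Φ (R p) + (P (R p) - c))
    (hmass : dirDeriv timeDir R p + ∑ i, dirDeriv (spaceDir i) (fun q => R q * U i q) p = 0) :
    dirDeriv timeDir (fun q => Φ (R q)) p
      + ∑ j, dirDeriv (spaceDir j) (fun q => (Φ (R q) + (P (R q) + -c)) * U j q) p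
    = ∑ i, U i p * dirDeriv (spaceDir i) (fun q => P (R q)) p := by
  have hflux : ∀ j, dirDeriv (spaceDir j) (fun q => (Φ (R q) + (P (R q) + -c)) * U j q) p
      = (Φ' + P') * dirDeriv (spaceDir j) R p * U j p
        + (Φ (R p) + (P (R p) + -c)) * dirDeriv (spaceDir j) (U j) p := fun j => by
    rw [dirDeriv_mul (hΦR.fun_add (hPR.fun_add (differentiable_const _))) (hU j),
      dirDeriv_add hΦR (hPR.fun_add (differentiable_const _)),
      dirDeriv_add hPR (differentiable_const _), dirDeriv_const, dirDeriv_comp hΦ hR,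
      dirDeriv_comp hP hR]
    ring
  simp only [hflux, dirDeriv_comp hΦ hR, dirDeriv_comp hP hR, dirDeriv_mul hR (hU _),
    Fin.sum_univ_three] at hmass ⊢
  linear_combination Φ' * hmass - (dirDeriv (spaceDir 0) (U 0) p
    + dirDeriv (spaceDir 1) (U 1) p + dirDeriv (spaceDir 2) (U 2) p) * hΦP

lemma viscous_balance (a b : ℝ) (hU : ∀ i, Differentiable ℝ (U i))
    (hDU : ∀ i j, Differentiable ℝ (dirDeriv (spaceDir j) (U i))) :
    ∑ j, dirDeriv (spaceDir j) (fun q => a * (∑ i, U i q * dirDeriv (spaceDir j) (U i) q)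
      + b * (U j q * ∑ i, dirDeriv (spaceDir i) (U i) q)) p
    = ∑ i, U i p * (a * ∑ j, dirDeriv (spaceDir j) (dirDeriv (spaceDir j) (U i)) p
      + b * dirDeriv (spaceDir i) (fun q => ∑ j, dirDeriv (spaceDir j) (U j) q) p)
    + a * (∑ i, ∑ j, dirDeriv (spaceDir j) (U i) p ^ 2)
    + b * (∑ j, dirDeriv (spaceDir j) (U j) p) ^ 2 := by
  simp only [Fin.sum_univ_three]
  simp (disch := fun_prop) only [dirDeriv_mul, dirDeriv_add, dirDeriv_const]
  ring

end LocalBalance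

section PressurePotential

/-- The internal energy density at density `r`, relative to the reference density `c`, of a
barotropic gas with pressure law `P`. -/
noncomputable def pressurePotential (P : ℝ → ℝ) (c r : ℝ) : ℝ :=
  r * ∫ s in c..r, (P s - P c) / s ^ 2

variable {P : ℝ → ℝ} {c r : ℝ}

lemma hasDerivAt_integral_right_of_pos {f : ℝ → ℝ} (hf : ContinuousOn f (Set.Ioi 0))
    (hc : 0 < c) (hr : 0 < r) : HasDerivAt (fun r => ∫ s in c..r, f s) (f r) r := by
  have hsub : Set.uIcc c r ⊆ Set.Ioi 0 := fun s hs => (lt_min hc hr).trans_le hs.1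
  exact intervalIntegral.integral_hasDerivAt_right (hf.mono hsub).intervalIntegrable
    (hf.stronglyMeasurableAtFilter isOpen_Ioi r hr) (hf.continuousAt (Ioi_mem_nhds hr))

lemma continuousOn_pressure_div_sq (hP : ContinuousOn P (Set.Ioi 0)) (a : ℝ) :
    ContinuousOn (fun s => (P s - a) / s ^ 2) (Set.Ioi 0) :=
  (hP.sub continuousOn_const).div (by fun_prop) fun s (hs : 0 < s) => by positivity

lemma hasDerivAt_pressurePotential (hP : ContinuousOn P (Set.Ioi 0)) (hc : 0 < c) (hr : 0 < r) :
    HasDerivAt (pressurePotential P c) ((pressurePotential P c r + (P r - P c)) / r) r := by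
  refine HasDerivAt.congr_deriv (f := pressurePotential P c) ((hasDerivAt_id r).mul
    (hasDerivAt_integral_right_of_pos (continuousOn_pressure_div_sq hP (P c)) hc hr)) ?_
  simp only [pressurePotential, id]
  field_simp

lemma contDiffOn_pressurePotential (hP : ContinuousOn P (Set.Ioi 0)) (hc : 0 < c) :
    ContDiffOn ℝ 1 (pressurePotential P c) (Set.Ioi 0) := by
  have hd : DifferentiableOn ℝ (pressurePotential P c) (Set.Ioi 0) := fun r hr =>
    (hasDerivAt_pressurePotential hP hc hr).differentiableAt.differentiableWithinAt
  rw [show (1 : WithTop ℕ∞) = 0 + 1 from rfl, contDiffOn_succ_iff_deriv_of_isOpen isOpen_Ioi]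
  refine ⟨hd, by simp, contDiffOn_zero.2 ?_⟩
  refine ((hd.continuousOn.add (hP.sub continuousOn_const)).div continuousOn_id
    fun s (hs : 0 < s) => hs.ne').congr fun r hr => (hasDerivAt_pressurePotential hP hc hr).deriv

end PressurePotential

section SpacePeriodic

variable {α β : Type*}

lemma SpacePeriodic.map {F : (Fin 3 → ℝ) × ℝ → α} (hF : SpacePeriodic F) (Φ : α → β) :
    SpacePeriodic fun q => Φ (F q) :=
  fun x t k => congrArg Φ (hF x t k)

lemma SpacePeriodic.map₂ {γ : Type*} {F : (Fin 3 → ℝ) × ℝ → α} {G : (Fin 3 → ℝ) × ℝ → β}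
    (hF : SpacePeriodic F) (hG : SpacePeriodic G) (Φ : α → β → γ) :
    SpacePeriodic fun q => Φ (F q) (G q) :=
  fun x t k => congrArg₂ Φ (hF x t k) (hG x t k)

lemma SpacePeriodic.sum {ι : Type*} {s : Finset ι} {F : ι → (Fin 3 → ℝ) × ℝ → ℝ}
    (hF : ∀ i, SpacePeriodic (F i)) : SpacePeriodic fun q => ∑ i ∈ s, F i q :=
  fun x t k => Finset.sum_congr rfl fun i _ => hF i x t k

end SpacePeriodic

section Averages

variable {R : (Fin 3 → ℝ) × ℝ → ℝ} {U : Fin 3 → (Fin 3 → ℝ) × ℝ → ℝ}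

lemma integral_slice_pos (hR : Continuous R) (hpos : ∀ p, 0 < R p) (t : ℝ) :
    0 < ∫ x in Set.Icc (0 : Fin 3 → ℝ) 1, R (x, t) := by
  rw [integral_pos_iff_support_of_nonneg (fun x => (hpos (x, t)).le) (integrableOn_slice hR t)]
  have : Function.support (fun x => R (x, t)) = Set.univ :=
    Set.eq_univ_of_forall fun x => (hpos (x, t)).ne'
  simp [this, Real.volume_Icc_pi]

/-- A quantity satisfying a conservation law with periodic flux has constant integral. -/
lemma integral_slice_eq_of_conservation {F : (Fin 3 → ℝ) × ℝ → ℝ}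
    {G : Fin 3 → (Fin 3 → ℝ) × ℝ → ℝ} (hF : ContDiff ℝ 1 F) (hG : ∀ i, ContDiff ℝ 1 (G i))
    (hper : ∀ i, SpacePeriodic (G i))
    (hcons : ∀ p, dirDeriv timeDir F p + ∑ i, dirDeriv (spaceDir i) (G i) p = 0) (s t : ℝ) :
    ∫ x in Set.Icc (0 : Fin 3 → ℝ) 1, F (x, s) = ∫ x in Set.Icc (0 : Fin 3 → ℝ) 1, F (x, t) := by
  have h := hasDerivAt_integral_of_balance (H := fun _ => 0) hF hG hper hcons
  exact is_const_of_deriv_eq_zero (fun τ => (h τ).differentiableAt)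
    (fun τ => by simpa using (h τ).deriv) s t

lemma integral_fluctuation (hR : Continuous R) (hU : ∀ i, Continuous (U i)) {c t : ℝ}
    {m : Fin 3 → ℝ} (hc : ∫ x in Set.Icc (0 : Fin 3 → ℝ) 1, R (x, t) = c)
    (hm : ∀ i, ∫ x in Set.Icc (0 : Fin 3 → ℝ) 1, R (x, t) * U i (x, t) = c * m i) :
    ∫ x in Set.Icc (0 : Fin 3 → ℝ) 1, R (x, t) * ∑ i, (U i (x, t) - m i) ^ 2
      = (∫ x in Set.Icc (0 : Fin 3 → ℝ) 1, R (x, t) * ∑ i, U i (x, t) ^ 2)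
        - c * ∑ i, m i ^ 2 := by
  have hexp : ∀ x, R (x, t) * ∑ i, (U i (x, t) - m i) ^ 2
      = R (x, t) * (∑ i, U i (x, t) ^ 2) - (∑ i, 2 * m i * (R (x, t) * U i (x, t)))
        + (∑ i, m i ^ 2) * R (x, t) := fun x => by
    simp only [Fin.sum_univ_three]; ring
  have h1 := integrableOn_slice (F := fun q => R q * ∑ i, U i q ^ 2) (by fun_prop) t
  have h2 := fun i => integrableOn_slice (F := fun q => 2 * m i * (R q * U i q)) (by fun_prop) t
  have h3 := integrableOn_slice (F := fun q => (∑ i, m i ^ 2) * R q) (by fun_prop) t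
  have h4 := integrableOn_slice
    (F := fun q => R q * (∑ i, U i q ^ 2) - ∑ i, 2 * m i * (R q * U i q)) (by fun_prop) t
  simp only [hexp]
  rw [integral_add h4 h3,
    integral_sub h1 (integrable_finsetSum _ fun i _ => h2 i),
    integral_finsetSum _ fun i _ => h2 i]
  simp only [integral_const_mul, hc, hm, Fin.sum_univ_three]
  ring

lemma integral_smul_apply (hR : Continuous R) {u : (Fin 3 → ℝ) × ℝ → Fin 3 → ℝ}
    (hu : Continuous u) (t : ℝ) (i : Fin 3) :
    (∫ x in Set.Icc (0 : Fin 3 → ℝ) 1, R (x, t) • u (x, t)) i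
      = ∫ x in Set.Icc (0 : Fin 3 → ℝ) 1, R (x, t) * u (x, t) i := by
  rw [eval_integral fun j => integrableOn_slice (F := fun q => (R q • u q) j) (by fun_prop) t]
  simp

end Averages

section TwoFluid

variable {R N W : (Fin 3 → ℝ) × ℝ → ℝ} {U V : Fin 3 → (Fin 3 → ℝ) × ℝ → ℝ} {a b : ℝ}

/-- The drag and all fluxes cancel in the total momentum. -/
lemma integral_momentum_eq (hR : ContDiff ℝ 1 R) (hN : ContDiff ℝ 1 N) (hW : ContDiff ℝ 1 W)
    (hU : ∀ i, ContDiff ℝ 1 (U i)) (hV : ∀ i, ContDiff ℝ 2 (V i))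
    (hRper : SpacePeriodic R) (hNper : SpacePeriodic N) (hWper : SpacePeriodic W)
    (hUper : ∀ i, SpacePeriodic (U i)) (hVper : ∀ i, SpacePeriodic (V i))
    (hmomU : ∀ p i, dirDeriv timeDir (fun q => R q * U i q) p
      + ∑ j, dirDeriv (spaceDir j) (fun q => R q * U i q * U j q) p
      + dirDeriv (spaceDir i) R p = -(R p * (U i p - V i p)))
    (hmomV : ∀ p i, dirDeriv timeDir (fun q => N q * V i q) p
      + ∑ j, dirDeriv (spaceDir j) (fun q => N q * V i q * V j q) p
      + dirDeriv (spaceDir i) W p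
      + (-(a * ∑ j, dirDeriv (spaceDir j) (dirDeriv (spaceDir j) (V i)) p)
        - b * dirDeriv (spaceDir i) (fun q => ∑ j, dirDeriv (spaceDir j) (V j) q) p)
      = R p * (U i p - V i p)) (i : Fin 3) (s t : ℝ) :
    ∫ x in Set.Icc (0 : Fin 3 → ℝ) 1, (R (x, s) * U i (x, s) + N (x, s) * V i (x, s))
      = ∫ x in Set.Icc (0 : Fin 3 → ℝ) 1, (R (x, t) * U i (x, t) + N (x, t) * V i (x, t)) := by
  have hDV : ∀ i j, ContDiff ℝ 1 (dirDeriv (spaceDir j) (V i)) := fun i j =>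
    (hV i).dirDeriv (by norm_num)
  have hV1 : ∀ i, ContDiff ℝ 1 (V i) := fun i => (hV i).of_le (by norm_num)
  have hdR := hR.differentiable one_ne_zero
  have hdN := hN.differentiable one_ne_zero
  have hdW := hW.differentiable one_ne_zero
  have hdU := fun i => (hU i).differentiable one_ne_zero
  have hdV := fun i => (hV1 i).differentiable one_ne_zero
  have hdDV := fun i j => (hDV i j).differentiable one_ne_zero
  refine integral_slice_eq_of_conservation
    (F := fun q => R q * U i q + N q * V i q)
    (G := fun j q => R q * U i q * U j q + N q * V i q * V j q
      + (if i = j then 1 else 0) * (R q + W q + -b * ∑ k, dirDeriv (spaceDir k) (V k) q)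
      + -a * dirDeriv (spaceDir j) (V i) q)
    (by fun_prop) (fun j => by fun_prop) (fun j => ?_) (fun p => ?_) s t
  · have hdiv : SpacePeriodic fun q => ∑ k, dirDeriv (spaceDir k) (V k) q :=
      .sum fun k => (hVper k).dirDeriv
    intro x τ k
    have := hdiv x τ k
    simp only [hRper x τ k, hNper x τ k, hWper x τ k, hUper _ x τ k, hVper _ x τ k, this,
      (hVper i).dirDeriv x τ k]
  · have hQ : Differentiable ℝ fun q => ∑ k, dirDeriv (spaceDir k) (V k) q := by fun_prop
    have hsplit : ∀ j, dirDeriv (spaceDir j) (fun q => R q * U i q * U j q + N q * V i q * V j q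
        + (if i = j then 1 else 0) * (R q + W q + -b * ∑ k, dirDeriv (spaceDir k) (V k) q)
        + -a * dirDeriv (spaceDir j) (V i) q) p
        = dirDeriv (spaceDir j) (fun q => R q * U i q * U j q) p
          + dirDeriv (spaceDir j) (fun q => N q * V i q * V j q) p
          + (if i = j then (dirDeriv (spaceDir j) R p + dirDeriv (spaceDir j) W p
            - b * dirDeriv (spaceDir j) (fun q => ∑ k, dirDeriv (spaceDir k) (V k) q) p) else 0)
          - a * dirDeriv (spaceDir j) (dirDeriv (spaceDir j) (V i)) p := fun j => by
      rw [dirDeriv_add (by fun_prop) (by fun_prop), dirDeriv_add (by fun_prop) (by fun_prop),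
        dirDeriv_add (by fun_prop) (by fun_prop), dirDeriv_const_mul _ (by fun_prop),
        dirDeriv_const_mul (-a) (by fun_prop),
        dirDeriv_add (by fun_prop) (by fun_prop), dirDeriv_add (by fun_prop) (by fun_prop),
        dirDeriv_const_mul (-b) (by fun_prop)]
      split_ifs <;> ring
    simp only [hsplit, Finset.sum_sub_distrib, Finset.sum_add_distrib, Finset.sum_ite_eq,
      Finset.mem_univ, if_true, ← Finset.mul_sum]
    rw [dirDeriv_add (by fun_prop) (by fun_prop)]
    linear_combination hmomU p i + hmomV p i

lemma hasDerivAt_integral_energy {Φ Ψ P : ℝ → ℝ} {c d : ℝ}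
    (hR : ContDiff ℝ 1 R) (hN : ContDiff ℝ 1 N)
    (hU : ∀ i, ContDiff ℝ 1 (U i)) (hV : ∀ i, ContDiff ℝ 2 (V i))
    (hRper : SpacePeriodic R) (hNper : SpacePeriodic N)
    (hUper : ∀ i, SpacePeriodic (U i)) (hVper : ∀ i, SpacePeriodic (V i))
    (hΦR : ContDiff ℝ 1 fun q => Φ (R q)) (hΨN : ContDiff ℝ 1 fun q => Ψ (N q))
    (hPN : ContDiff ℝ 1 fun q => P (N q))
    (hΦ : ∀ p, ∃ Φ', HasDerivAt Φ Φ' (R p) ∧ R p * Φ' = Φ (R p) + (R p - c))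
    (hΨ : ∀ p, ∃ Ψ', HasDerivAt Ψ Ψ' (N p) ∧ N p * Ψ' = Ψ (N p) + (P (N p) - d))
    (hP : ∀ p, DifferentiableAt ℝ P (N p))
    (hmassU : ∀ p, dirDeriv timeDir R p
      + ∑ i, dirDeriv (spaceDir i) (fun q => R q * U i q) p = 0)
    (hmassV : ∀ p, dirDeriv timeDir N p
      + ∑ i, dirDeriv (spaceDir i) (fun q => N q * V i q) p = 0)
    (hmomU : ∀ p i, dirDeriv timeDir (fun q => R q * U i q) p
      + ∑ j, dirDeriv (spaceDir j) (fun q => R q * U i q * U j q) p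
      + dirDeriv (spaceDir i) R p = -(R p * (U i p - V i p)))
    (hmomV : ∀ p i, dirDeriv timeDir (fun q => N q * V i q) p
      + ∑ j, dirDeriv (spaceDir j) (fun q => N q * V i q * V j q) p
      + dirDeriv (spaceDir i) (fun q => P (N q)) p
      + (-(a * ∑ j, dirDeriv (spaceDir j) (dirDeriv (spaceDir j) (V i)) p)
        - b * dirDeriv (spaceDir i) (fun q => ∑ j, dirDeriv (spaceDir j) (V j) q) p)
      = R p * (U i p - V i p)) (t : ℝ) :
    HasDerivAt (fun s => ∫ x in Set.Icc (0 : Fin 3 → ℝ) 1,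
        (1 / 2 * (R (x, s) * ∑ i, U i (x, s) ^ 2) + Φ (R (x, s))
          + 1 / 2 * (N (x, s) * ∑ i, V i (x, s) ^ 2) + Ψ (N (x, s))))
      (∫ x in Set.Icc (0 : Fin 3 → ℝ) 1,
        -(a * (∑ i, ∑ j, dirDeriv (spaceDir j) (V i) (x, t) ^ 2)
          + b * (∑ j, dirDeriv (spaceDir j) (V j) (x, t)) ^ 2
          + R (x, t) * ∑ i, (U i (x, t) - V i (x, t)) ^ 2)) t := by
  have hDV : ∀ i j, ContDiff ℝ 1 (dirDeriv (spaceDir j) (V i)) := fun i j =>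
    (hV i).dirDeriv (by norm_num)
  have hV1 : ∀ i, ContDiff ℝ 1 (V i) := fun i => (hV i).of_le (by norm_num)
  have hdR := hR.differentiable one_ne_zero
  have hdN := hN.differentiable one_ne_zero
  have hdU := fun i => (hU i).differentiable one_ne_zero
  have hdV := fun i => (hV1 i).differentiable one_ne_zero
  have hdDV := fun i j => (hDV i j).differentiable one_ne_zero
  have hdΦR := hΦR.differentiable one_ne_zero
  have hdΨN := hΨN.differentiable one_ne_zero
  have hdPN := hPN.differentiable one_ne_zero
  have hkinU : ContDiff ℝ 1 fun q => 1 / 2 * (R q * ∑ i, U i q ^ 2) := by fun_prop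
  have hkinV : ContDiff ℝ 1 fun q => 1 / 2 * (N q * ∑ i, V i q ^ 2) := by fun_prop
  have hintU : ∀ j, ContDiff ℝ 1 fun q => (Φ (R q) + (R q + -c)) * U j q := fun j =>
    (hΦR.add (hR.add contDiff_const)).mul (hU j)
  have hintV : ∀ j, ContDiff ℝ 1 fun q => (Ψ (N q) + (P (N q) + -d)) * V j q := fun j =>
    (hΨN.add (hPN.add contDiff_const)).mul (hV1 j)
  have hvis : ∀ j, ContDiff ℝ 1 fun q => a * (∑ i, V i q * dirDeriv (spaceDir j) (V i) q)
      + b * (V j q * ∑ i, dirDeriv (spaceDir i) (V i) q) := fun j => by fun_prop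
  have hkinU' := hkinU.differentiable one_ne_zero
  have hkinV' := hkinV.differentiable one_ne_zero
  have hintU' := fun j => (hintU j).differentiable one_ne_zero
  have hintV' := fun j => (hintV j).differentiable one_ne_zero
  have hvis' := fun j => (hvis j).differentiable one_ne_zero
  have hkinUU : ∀ j, Differentiable ℝ fun q => 1 / 2 * (R q * ∑ i, U i q ^ 2) * U j q :=
    fun j => by fun_prop
  have hkinVV : ∀ j, Differentiable ℝ fun q => 1 / 2 * (N q * ∑ i, V i q ^ 2) * V j q :=
    fun j => by fun_prop
  refine hasDerivAt_integral_of_balance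
    (F := fun q => 1 / 2 * (R q * ∑ i, U i q ^ 2) + Φ (R q)
      + 1 / 2 * (N q * ∑ i, V i q ^ 2) + Ψ (N q))
    (G := fun j q => 1 / 2 * (R q * ∑ i, U i q ^ 2) * U j q + (Φ (R q) + (R q + -c)) * U j q
      + 1 / 2 * (N q * ∑ i, V i q ^ 2) * V j q + (Ψ (N q) + (P (N q) + -d)) * V j q
      + -1 * (a * (∑ i, V i q * dirDeriv (spaceDir j) (V i) q)
        + b * (V j q * ∑ i, dirDeriv (spaceDir i) (V i) q)))
    (H := fun q => -(a * (∑ i, ∑ j, dirDeriv (spaceDir j) (V i) q ^ 2)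
          + b * (∑ j, dirDeriv (spaceDir j) (V j) q) ^ 2
          + R q * ∑ i, (U i q - V i q) ^ 2))
    (((hkinU.add hΦR).add hkinV).add hΨN)
    (fun j => (((((hkinU.mul (hU j)).add (hintU j)).add (hkinV.mul (hV1 j))).add
      (hintV j)).add (contDiff_const.mul (hvis j)))) (fun j => ?_) (fun p => ?_) t
  · intro x τ k
    simp only [hRper x τ k, hNper x τ k, hUper _ x τ k, hVper _ x τ k,
      (hVper _).dirDeriv x τ k]
  · obtain ⟨Φ', hΦ', hRΦ'⟩ := hΦ p
    obtain ⟨Ψ', hΨ', hNΨ'⟩ := hΨ p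
    have hflux : ∀ j, dirDeriv (spaceDir j) (fun q => 1 / 2 * (R q * ∑ i, U i q ^ 2) * U j q
          + (Φ (R q) + (R q + -c)) * U j q + 1 / 2 * (N q * ∑ i, V i q ^ 2) * V j q
          + (Ψ (N q) + (P (N q) + -d)) * V j q
          + -1 * (a * (∑ i, V i q * dirDeriv (spaceDir j) (V i) q)
            + b * (V j q * ∑ i, dirDeriv (spaceDir i) (V i) q))) p
        = dirDeriv (spaceDir j) (fun q => 1 / 2 * (R q * ∑ i, U i q ^ 2) * U j q) p
          + dirDeriv (spaceDir j) (fun q => (Φ (R q) + (R q + -c)) * U j q) p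
          + dirDeriv (spaceDir j) (fun q => 1 / 2 * (N q * ∑ i, V i q ^ 2) * V j q) p
          + dirDeriv (spaceDir j) (fun q => (Ψ (N q) + (P (N q) + -d)) * V j q) p
          - dirDeriv (spaceDir j) (fun q => a * (∑ i, V i q * dirDeriv (spaceDir j) (V i) q)
            + b * (V j q * ∑ i, dirDeriv (spaceDir i) (V i) q)) p := fun j => by
      rw [dirDeriv_add ((((hkinUU j).fun_add (hintU' j)).fun_add (hkinVV j)).fun_add (hintV' j))
          ((hvis' j).const_mul _), dirDeriv_const_mul (-1) (hvis' j),
        dirDeriv_add (((hkinUU j).fun_add (hintU' j)).fun_add (hkinVV j)) (hintV' j),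
        dirDeriv_add ((hkinUU j).fun_add (hintU' j)) (hkinVV j),
        dirDeriv_add (hkinUU j) (hintU' j)]
      ring
    rw [dirDeriv_add ((hkinU'.fun_add hdΦR).fun_add hkinV') hdΨN,
      dirDeriv_add (hkinU'.fun_add hdΦR) hkinV', dirDeriv_add hkinU' hdΦR]
    simp only [hflux, Finset.sum_sub_distrib, Finset.sum_add_distrib]
    have k1 := kinetic_balance hdR hdU (hmassU p)
    have k2 := kinetic_balance hdN hdV (hmassV p)
    have i1 := internal_balance (P := fun r => r) hdR hdU hdΦR hdR hΦ' (hasDerivAt_id' _)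
      hRΦ' (hmassU p)
    have i2 := internal_balance hdN hdV hdΨN hdPN hΨ' (hP p).hasDerivAt hNΨ' (hmassV p)
    have v1 := viscous_balance (p := p) a b hdV hdDV
    have mU : ∑ i, U i p * (dirDeriv timeDir (fun q => R q * U i q) p
        + ∑ j, dirDeriv (spaceDir j) (fun q => R q * U i q * U j q) p)
        + ∑ i, U i p * dirDeriv (spaceDir i) R p = ∑ i, U i p * -(R p * (U i p - V i p)) := by
      simp only [← Finset.sum_add_distrib, ← mul_add, hmomU]
    have mV : ∑ i, V i p * (dirDeriv timeDir (fun q => N q * V i q) p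
        + ∑ j, dirDeriv (spaceDir j) (fun q => N q * V i q * V j q) p)
        + ∑ i, V i p * dirDeriv (spaceDir i) (fun q => P (N q)) p
        = ∑ i, V i p * (a * ∑ j, dirDeriv (spaceDir j) (dirDeriv (spaceDir j) (V i)) p
          + b * dirDeriv (spaceDir i) (fun q => ∑ j, dirDeriv (spaceDir j) (V j) q) p)
        + ∑ i, V i p * (R p * (U i p - V i p)) := by
      simp only [← Finset.sum_add_distrib, ← mul_add]
      exact Finset.sum_congr rfl fun i _ => by rw [← hmomV p i]; ring
    have drag : ∑ i, U i p * -(R p * (U i p - V i p)) + ∑ i, V i p * (R p * (U i p - V i p))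
        = -(R p * ∑ i, (U i p - V i p) ^ 2) := by
      simp only [Fin.sum_univ_three]; ring
    linear_combination k1 + k2 + i1 + i2 - v1 + mU + mV + drag

end TwoFluid

/-- Lemma 5.1: the modified temporal energy 𝓔, measuring fluctuations around
the averaged momenta m_c, j_c, satisfies 𝓔′(t) + 𝓓(t) = 0, where 𝓓 is the
dissipation μ∫|∇v|² + (μ+λ)∫|div v|² + ∫ρ|u−v|². -/
theorem temporal_energy_dissipation
    (γ μ lam : ℝ) (hγ : 1 < γ) (hμ : 0 < μ) (hlam : 0 < lam + 2 * μ)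
    (ρ n : (Fin 3 → ℝ) × ℝ → ℝ) (u v : (Fin 3 → ℝ) × ℝ → Fin 3 → ℝ)
    (hρ : ContDiff ℝ (⊤ : ℕ∞) ρ) (hn : ContDiff ℝ (⊤ : ℕ∞) n)
    (hu : ContDiff ℝ (⊤ : ℕ∞) u) (hv : ContDiff ℝ (⊤ : ℕ∞) v)
    (hρper : ∀ (x : Fin 3 → ℝ) (t : ℝ) (k : Fin 3 → ℤ),
      ρ ((x + fun i => (k i : ℝ)), t) = ρ (x, t))
    (hnper : ∀ (x : Fin 3 → ℝ) (t : ℝ) (k : Fin 3 → ℤ),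
      n ((x + fun i => (k i : ℝ)), t) = n (x, t))
    (huper : ∀ (x : Fin 3 → ℝ) (t : ℝ) (k : Fin 3 → ℤ),
      u ((x + fun i => (k i : ℝ)), t) = u (x, t))
    (hvper : ∀ (x : Fin 3 → ℝ) (t : ℝ) (k : Fin 3 → ℤ),
      v ((x + fun i => (k i : ℝ)), t) = v (x, t))
    (hρpos : ∀ p, 0 < ρ p) (hnpos : ∀ p, 0 < n p)
    -- continuity equation for ρ
    (heq1 : ∀ (x : Fin 3 → ℝ) (t : ℝ),
      deriv (fun s => ρ (x, s)) t
        + ∑ i, pd i (fun y => ρ (y, t) * u (y, t) i) x = 0)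
    -- momentum equation for ρu (isothermal Euler with drag)
    (heq2 : ∀ (x : Fin 3 → ℝ) (t : ℝ) (i : Fin 3),
      deriv (fun s => ρ (x, s) * u (x, s) i) t
        + ∑ j, pd j (fun y => ρ (y, t) * u (y, t) i * u (y, t) j) x
        + pd i (fun y => ρ (y, t)) x
        = -(ρ (x, t) * (u (x, t) i - v (x, t) i)))
    -- continuity equation for n
    (heq3 : ∀ (x : Fin 3 → ℝ) (t : ℝ),
      deriv (fun s => n (x, s)) t
        + ∑ i, pd i (fun y => n (y, t) * v (y, t) i) x = 0)
    -- momentum equation for nv (isentropic Navier–Stokes with drag),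
    -- with Lv = −μΔv − (μ+λ)∇(div v)
    (heq4 : ∀ (x : Fin 3 → ℝ) (t : ℝ) (i : Fin 3),
      deriv (fun s => n (x, s) * v (x, s) i) t
        + ∑ j, pd j (fun y => n (y, t) * v (y, t) i * v (y, t) j) x
        + pd i (fun y => n (y, t) ^ γ) x
        + (-(μ * ∑ j, pd j (fun y => pd j (fun z => v (z, t) i) y) x)
            - (μ + lam) * pd i (fun y => ∑ j, pd j (fun z => v (z, t) j) y) x)
        = ρ (x, t) * (u (x, t) i - v (x, t) i)) :
    ∀ ρc nc : ℝ,
      ρc = (∫ x in Set.Icc (0 : Fin 3 → ℝ) 1, ρ (x, 0)) →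
      nc = (∫ x in Set.Icc (0 : Fin 3 → ℝ) 1, n (x, 0)) →
    ∀ mc jc : ℝ → Fin 3 → ℝ,
      (∀ τ : ℝ, mc τ = ρc⁻¹ • ∫ x in Set.Icc (0 : Fin 3 → ℝ) 1, ρ (x, τ) • u (x, τ)) →
      (∀ τ : ℝ, jc τ = nc⁻¹ • ∫ x in Set.Icc (0 : Fin 3 → ℝ) 1, n (x, τ) • v (x, τ)) →
    ∀ E : ℝ → ℝ,
      (∀ τ : ℝ, E τ =
        (1 / 2) * (∫ x in Set.Icc (0 : Fin 3 → ℝ) 1,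
            ρ (x, τ) * ∑ i, (u (x, τ) i - mc τ i) ^ 2)
        + (∫ x in Set.Icc (0 : Fin 3 → ℝ) 1,
            ρ (x, τ) * ∫ s in ρc..(ρ (x, τ)), (s - ρc) / s ^ 2)
        + (1 / 2) * (∫ x in Set.Icc (0 : Fin 3 → ℝ) 1,
            n (x, τ) * ∑ i, (v (x, τ) i - jc τ i) ^ 2)
        + (∫ x in Set.Icc (0 : Fin 3 → ℝ) 1,
            n (x, τ) * ∫ s in nc..(n (x, τ)), (s ^ γ - nc ^ γ) / s ^ 2)
        + (1 / 2) * (nc * ρc / (nc + ρc)) * ∑ i, (mc τ i - jc τ i) ^ 2) →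
    ∀ t : ℝ,
      HasDerivAt E
        (-(μ * (∫ x in Set.Icc (0 : Fin 3 → ℝ) 1,
              ∑ i, ∑ j, (pd j (fun y => v (y, t) i) x) ^ 2)
          + (μ + lam) * (∫ x in Set.Icc (0 : Fin 3 → ℝ) 1,
              (∑ j, pd j (fun y => v (y, t) j) x) ^ 2)
          + ∫ x in Set.Icc (0 : Fin 3 → ℝ) 1,
              ρ (x, t) * ∑ i, (u (x, t) i - v (x, t) i) ^ 2)) t := by
  intro ρc nc hρc hnc mc jc hmc hjc E hE t
  have hui : ∀ i, ContDiff ℝ (⊤ : ℕ∞) fun q => u q i := contDiff_pi.1 hu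
  have hvi : ∀ i, ContDiff ℝ (⊤ : ℕ∞) fun q => v q i := contDiff_pi.1 hv
  have hupi : ∀ i, SpacePeriodic fun q => u q i := fun i => .map huper (· i)
  have hvpi : ∀ i, SpacePeriodic fun q => v q i := fun i => .map hvper (· i)
  have hρ1 : ContDiff ℝ 1 ρ := hρ.of_le (by exact_mod_cast le_top)
  have hn1 : ContDiff ℝ 1 n := hn.of_le (by exact_mod_cast le_top)
  have hu1 : ∀ i, ContDiff ℝ 1 fun q => u q i := fun i =>
    (hui i).of_le (by exact_mod_cast le_top)
  have hv2 : ∀ i, ContDiff ℝ 2 fun q => v q i := fun i =>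
    mod_cast contDiff_infty.1 (hvi i) 2
  have hv1 : ∀ i, ContDiff ℝ 1 fun q => v q i := fun i => (hv2 i).of_le (by norm_num)
  have hDv : ∀ i j, ContDiff ℝ 1 (dirDeriv (spaceDir j) fun q => v q i) := fun i j =>
    (hv2 i).dirDeriv (by norm_num)
  have hnγ : ContDiff ℝ 1 fun q => n q ^ γ := hn1.rpow_const_of_ne fun q => (hnpos q).ne'
  have hdρ := hρ1.differentiable one_ne_zero
  have hdn := hn1.differentiable one_ne_zero
  have hdnγ := hnγ.differentiable one_ne_zero
  have hdu := fun i => (hu1 i).differentiable one_ne_zero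
  have hdv := fun i => (hv1 i).differentiable one_ne_zero
  have hdDv := fun i j => (hDv i j).differentiable one_ne_zero
  have hdivv : Differentiable ℝ fun q => ∑ j, dirDeriv (spaceDir j) (fun q => v q j) q := by
    fun_prop
  have hpdv : ∀ i j x s, pd j (fun y => v (y, s) i) x
      = dirDeriv (spaceDir j) (fun q => v q i) (x, s) := fun i j x s => pd_slice (hdv i) j x s
  have massρ : ∀ p, dirDeriv timeDir ρ p
      + ∑ i, dirDeriv (spaceDir i) (fun q => ρ q * u q i) p = 0 := fun ⟨x, s⟩ => by
    rw [← heq1 x s, deriv_time hdρ]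
    exact congrArg _ (Finset.sum_congr rfl fun i _ =>
      (pd_slice (F := fun q => ρ q * u q i) (by fun_prop) i x s).symm)
  have massn : ∀ p, dirDeriv timeDir n p
      + ∑ i, dirDeriv (spaceDir i) (fun q => n q * v q i) p = 0 := fun ⟨x, s⟩ => by
    rw [← heq3 x s, deriv_time hdn]
    exact congrArg _ (Finset.sum_congr rfl fun i _ =>
      (pd_slice (F := fun q => n q * v q i) (by fun_prop) i x s).symm)
  have momρ : ∀ p i, dirDeriv timeDir (fun q => ρ q * u q i) p
      + ∑ j, dirDeriv (spaceDir j) (fun q => ρ q * u q i * u q j) p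
      + dirDeriv (spaceDir i) ρ p = -(ρ p * (u p i - v p i)) := fun ⟨x, s⟩ i => by
    rw [← heq2 x s i, ← deriv_time (by fun_prop), ← pd_slice hdρ]
    simp only [fun j => pd_slice (F := fun q => ρ q * u q i * u q j) (by fun_prop) j x s]
  have momn : ∀ p i, dirDeriv timeDir (fun q => n q * v q i) p
      + ∑ j, dirDeriv (spaceDir j) (fun q => n q * v q i * v q j) p
      + dirDeriv (spaceDir i) (fun q => n q ^ γ) p
      + (-(μ * ∑ j, dirDeriv (spaceDir j) (dirDeriv (spaceDir j) fun q => v q i) p)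
        - (μ + lam) * dirDeriv (spaceDir i)
          (fun q => ∑ j, dirDeriv (spaceDir j) (fun q => v q j) q) p)
      = ρ p * (u p i - v p i) := fun ⟨x, s⟩ i => by
    rw [← heq4 x s i, ← deriv_time (by fun_prop), ← pd_slice hdnγ, ← pd_slice hdivv]
    simp only [fun j => pd_slice (F := fun q => n q * v q i * v q j) (by fun_prop) j x s, hpdv,
      fun j => pd_slice (hdDv i j) j x s]
  have massρ_const : ∀ τ, ∫ x in Set.Icc (0 : Fin 3 → ℝ) 1, ρ (x, τ) = ρc := fun τ => by
    rw [hρc]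
    exact integral_slice_eq_of_conservation (G := fun i q => ρ q * u q i) hρ1
      (fun i => hρ1.mul (hu1 i)) (fun i => .map₂ hρper (hupi i) (· * ·)) massρ τ 0
  have massn_const : ∀ τ, ∫ x in Set.Icc (0 : Fin 3 → ℝ) 1, n (x, τ) = nc := fun τ => by
    rw [hnc]
    exact integral_slice_eq_of_conservation (G := fun i q => n q * v q i) hn1
      (fun i => hn1.mul (hv1 i)) (fun i => .map₂ hnper (hvpi i) (· * ·)) massn τ 0
  have hρc0 : 0 < ρc := hρc ▸ integral_slice_pos hρ.continuous hρpos 0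
  have hnc0 : 0 < nc := hnc ▸ integral_slice_pos hn.continuous hnpos 0
  have hmom_u : ∀ τ i, ∫ x in Set.Icc (0 : Fin 3 → ℝ) 1, ρ (x, τ) * u (x, τ) i
      = ρc * mc τ i := fun τ i => by
    rw [hmc, Pi.smul_apply, integral_smul_apply hρ.continuous hu.continuous, smul_eq_mul,
      mul_inv_cancel_left₀ hρc0.ne']
  have hmom_v : ∀ τ i, ∫ x in Set.Icc (0 : Fin 3 → ℝ) 1, n (x, τ) * v (x, τ) i
      = nc * jc τ i := fun τ i => by
    rw [hjc, Pi.smul_apply, integral_smul_apply hn.continuous hv.continuous, smul_eq_mul,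
      mul_inv_cancel_left₀ hnc0.ne']
  have hcρ := hρ.continuous
  have hcn := hn.continuous
  have hcu := fun i => (hu1 i).continuous
  have hcv := fun i => (hv1 i).continuous
  have htotal : ∀ τ i, ρc * mc τ i + nc * jc τ i = ρc * mc 0 i + nc * jc 0 i := fun τ i => by
    simp only [← hmom_u, ← hmom_v]
    have hadd : ∀ τ, ∫ x in Set.Icc (0 : Fin 3 → ℝ) 1,
        (ρ (x, τ) * u (x, τ) i + n (x, τ) * v (x, τ) i)
        = (∫ x in Set.Icc (0 : Fin 3 → ℝ) 1, ρ (x, τ) * u (x, τ) i)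
          + ∫ x in Set.Icc (0 : Fin 3 → ℝ) 1, n (x, τ) * v (x, τ) i := fun τ =>
      integral_add (integrableOn_slice (F := fun q => ρ q * u q i) (by fun_prop) τ)
        (integrableOn_slice (F := fun q => n q * v q i) (by fun_prop) τ)
    rw [← hadd, ← hadd]
    exact integral_momentum_eq hρ1 hn1 hnγ hu1 hv2 hρper hnper
      (.map hnper (· ^ γ)) hupi hvpi momρ momn i τ 0
  have hP : ContDiffOn ℝ 1 (fun r : ℝ => r ^ γ) (Set.Ioi 0) := fun r (hr : 0 < r) =>
    (Real.contDiffAt_rpow_const_of_ne hr.ne').contDiffWithinAt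
  set Φ := pressurePotential (fun r => r) ρc with hΦdef
  set Ψ := pressurePotential (fun r => r ^ γ) nc with hΨdef
  have hΦρ : ContDiff ℝ 1 fun q => Φ (ρ q) :=
    (contDiffOn_pressurePotential continuousOn_id hρc0).comp_contDiff hρ1 hρpos
  have hΨn : ContDiff ℝ 1 fun q => Ψ (n q) :=
    (contDiffOn_pressurePotential hP.continuousOn hnc0).comp_contDiff hn1 hnpos
  have hcΦ := hΦρ.continuous
  have hcΨ := hΨn.continuous
  have henergy := hasDerivAt_integral_energy (Φ := Φ) (Ψ := Ψ) (P := fun r => r ^ γ) (c := ρc)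
    (d := nc ^ γ) hρ1 hn1 hu1 hv2 hρper hnper hupi hvpi hΦρ hΨn hnγ
    (fun p => ⟨_, hasDerivAt_pressurePotential continuousOn_id hρc0 (hρpos p),
      mul_div_cancel₀ _ (hρpos p).ne'⟩)
    (fun p => ⟨_, hasDerivAt_pressurePotential hP.continuousOn hnc0 (hnpos p),
      mul_div_cancel₀ _ (hnpos p).ne'⟩)
    (fun p => Real.differentiableAt_rpow_const_of_ne γ (hnpos p).ne')
    massρ massn momρ momn t
  have hEeq : E = fun τ => (∫ x in Set.Icc (0 : Fin 3 → ℝ) 1,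
        (1 / 2 * (ρ (x, τ) * ∑ i, u (x, τ) i ^ 2) + Φ (ρ (x, τ))
          + 1 / 2 * (n (x, τ) * ∑ i, v (x, τ) i ^ 2) + Ψ (n (x, τ))))
      - (∑ i, (ρc * mc 0 i + nc * jc 0 i) ^ 2) / (2 * (nc + ρc)) := by
    funext τ
    have i1 := integrableOn_slice (F := fun q => 1 / 2 * (ρ q * ∑ i, u q i ^ 2))
      (by fun_prop) τ
    have i2 := integrableOn_slice hcΦ τ
    have i3 := integrableOn_slice (F := fun q => 1 / 2 * (n q * ∑ i, v q i ^ 2))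
      (by fun_prop) τ
    have i4 := integrableOn_slice hcΨ τ
    have i12 := i1.fun_add i2
    have i123 := i12.fun_add i3
    rw [hE τ, integral_fluctuation (U := fun i q => u q i) hcρ hcu (massρ_const τ) (hmom_u τ),
      integral_fluctuation (U := fun i q => v q i) hcn hcv (massn_const τ) (hmom_v τ),
      integral_add i123 i4, integral_add i12 i3, integral_add i1 i2, integral_const_mul,
      integral_const_mul]
    simp only [← htotal τ, hΦdef, hΨdef, pressurePotential, Fin.sum_univ_three]
    have : nc + ρc ≠ 0 := by positivity
    field_simp
    ring
  rw [hEeq]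
  refine (henergy.sub_const _).congr_deriv ?_
  simp only [hpdv]
  have j1 := integrableOn_slice
    (F := fun q => μ * ∑ i, ∑ j, dirDeriv (spaceDir j) (fun q => v q i) q ^ 2)
    (have := fun i j => (hDv i j).continuous; by fun_prop) t
  have j2 := integrableOn_slice
    (F := fun q => (μ + lam) * (∑ j, dirDeriv (spaceDir j) (fun q => v q j) q) ^ 2)
    (have := fun i j => (hDv i j).continuous; by fun_prop) t
  have j3 := integrableOn_slice (F := fun q => ρ q * ∑ i, (u q i - v q i) ^ 2) (by fun_prop) t
  rw [integral_neg, integral_add (j1.fun_add j2) j3, integral_add j1 j2, integral_const_mul,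
    integral_const_mul]
end
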